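/- arXiv:1001.0811 — 2 statements merged into one kernel-verified Lean document; each statement's English description precedes it below -/
import Mathlib

section
/- Let X be an n×n matrix over the finite field F_q with cycle type f^λ for a monic irreducible polynomial f of degree d, and let D be a similarity class of n×n matrices over F_q with cycle type g^λ for some monic irreducible polynomial g of degree d. Then there exists a polynomial F ∈ F_q[x] such that F(X) ∈ D. -/
open Polynomial Matrix

/-- Two square matrices over a commutative ring are *similar* if they are
conjugate by an invertible matrix. -/
def SimilarMat {m : Type*} [Fintype m] [DecidableEq m] {K : Type*} [CommRing K]
    (A B : Matrix m m K) : Prop :=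
  ∃ P : (Matrix m m K)ˣ, B = (↑P : Matrix m m K) * A * (↑P⁻¹ : Matrix m m K)

/-- `M` has (primary) cycle type `f ^ lam`: it is similar to a direct sum of
cyclic blocks, one for each part `h` of `lam`, each block having both
characteristic polynomial and minimal polynomial equal to `f ^ h`. -/
def HasPrimaryCycleType {K : Type*} [Field K] {n m : ℕ}
    (M : Matrix (Fin n) (Fin n) K) (f : Polynomial K) (lam : Nat.Partition m) : Prop :=
  ∃ L : List ℕ, (↑L : Multiset ℕ) = lam.parts ∧
    ∃ B : (i : Fin L.length) →
        Matrix (Fin (f.natDegree * L.get i)) (Fin (f.natDegree * L.get i)) K,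
      (∀ i, (B i).charpoly = f ^ L.get i ∧ minpoly K (B i) = f ^ L.get i) ∧
      ∃ e : ((i : Fin L.length) × Fin (f.natDegree * L.get i)) ≃ Fin n,
        SimilarMat (Matrix.reindex e e (Matrix.blockDiagonal' B)) M

/-- Evaluating a polynomial commutes with conjugation by a unit. -/
theorem aeval_units_conj {K A : Type*} [CommRing K] [Ring A] [Algebra K A] (F : K[X])
    (P : Aˣ) (a : A) :
    aeval ((P : A) * a * (↑P⁻¹ : A)) F = (P : A) * aeval a F * (↑P⁻¹ : A) := by
  simp only [aeval_eq_sum_range, Units.conj_pow, Finset.mul_sum, Finset.sum_mul,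
    mul_smul_comm, smul_mul_assoc]

/-- Evaluating a polynomial at a block diagonal matrix is done blockwise. -/
theorem aeval_blockDiagonal' {K o : Type*} [CommRing K] [Fintype o] [DecidableEq o]
    {m : o → Type*} [∀ i, Fintype (m i)] [∀ i, DecidableEq (m i)] (F : K[X])
    (B : (i : o) → Matrix (m i) (m i) K) :
    aeval (blockDiagonal' B) F = blockDiagonal' fun i => aeval (B i) F := by
  induction F using Polynomial.induction_on' with
  | add p q hp hq =>
    rw [map_add, hp, hq, ← blockDiagonal'_add]
    congr 1
    funext i
    simp
  | monomial k a =>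
    simp only [aeval_monomial, ← Algebra.smul_def, ← blockDiagonal'_pow, ← blockDiagonal'_smul]
    rfl

/-- Over a finite field, `g` has a root modulo any irreducible polynomial of the same degree. -/
theorem exists_dvd_comp_of_natDegree_eq {K : Type*} [Field K] [Finite K] {f g : K[X]}
    (hf : Irreducible f) (hg : Irreducible g) (hdeg : g.natDegree = f.natDegree) :
    ∃ F : K[X], f ∣ g.comp F := by
  have : Fact (Irreducible f) := ⟨hf⟩
  have : Fact (Irreducible g) := ⟨hg⟩
  have : Module.Finite K (AdjoinRoot f) := (AdjoinRoot.powerBasis hf.ne_zero).finite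
  have : Module.Finite K (AdjoinRoot g) := (AdjoinRoot.powerBasis hg.ne_zero).finite
  have : Finite (AdjoinRoot f) := Module.finite_of_finite K
  have : Finite (AdjoinRoot g) := Module.finite_of_finite K
  have hrank : Module.finrank K (AdjoinRoot g) = Module.finrank K (AdjoinRoot f) := by
    rw [(AdjoinRoot.powerBasis hf.ne_zero).finrank, (AdjoinRoot.powerBasis hg.ne_zero).finrank]
    simpa using hdeg
  obtain ⟨φ⟩ := FiniteField.nonempty_algHom_of_finrank_dvd hrank.dvd
  obtain ⟨F, hF⟩ := AdjoinRoot.mk_surjective (φ (AdjoinRoot.root g))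
  refine ⟨F, ?_⟩
  rw [← AdjoinRoot.mk_eq_zero, ← AdjoinRoot.aeval_eq, aeval_comp, AdjoinRoot.aeval_eq, hF,
    aeval_algHom_apply, AdjoinRoot.aeval_eq, AdjoinRoot.mk_self, map_zero]

/-- A root of `g` modulo `f` can be adjusted to be a simple zero at `f`. -/
theorem exists_comp_eq_mul_isCoprime {K : Type*} [Field K] [Finite K] {f g : K[X]}
    (hf : Irreducible f) (hg : Irreducible g) (hdeg : g.natDegree = f.natDegree) :
    ∃ F u : K[X], g.comp F = f * u ∧ IsCoprime f u := by
  obtain ⟨F, u, hu⟩ := exists_dvd_comp_of_natDegree_eq hf hg hdeg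
  by_cases hfu : f ∣ u
  · have hsep : IsCoprime (g.comp F) ((derivative g).comp F) := by
      have h : IsCoprime g (derivative g) := PerfectField.separable_of_irreducible hg
      exact h.map (compRingHom F)
    have hnd : ¬ f ∣ (derivative g).comp F := fun h =>
      hf.not_isUnit (hsep.isUnit_of_dvd' ⟨u, hu⟩ h)
    obtain ⟨k, hk⟩ := (g.map C).binomExpansion F f
    simp only [derivative_map, eval_map] at hk
    refine ⟨F + f, u + (derivative g).comp F + k * f, ?_, ?_⟩
    · change g.comp (F + f) = g.comp F + (derivative g).comp F * f + k * f ^ 2 at hk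
      rw [hk, hu]
      ring
    · rw [hf.coprime_iff_not_dvd]
      intro h
      refine hnd ?_
      rwa [dvd_add_left (dvd_mul_left _ _), dvd_add_right hfu] at h
  · exact ⟨F, u, hu, hf.coprime_iff_not_dvd.2 hfu⟩

/-- If `g ∘ F` is `f` times a polynomial coprime to `f`, then `F` transports minimal polynomials
`f ^ h` to `g ^ h`. -/
theorem minpoly_aeval_eq_pow {K A : Type*} [Field K] [Ring A] [Algebra K A]
    {f g F u : K[X]} (hf : Irreducible f) (hgm : g.Monic) (hg : Irreducible g)
    (hcomp : g.comp F = f * u) (hcop : IsCoprime f u) {a : A} (ha : IsIntegral K (aeval a F))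
    {h : ℕ} (hmin : minpoly K a = f ^ h) :
    minpoly K (aeval a F) = g ^ h := by
  have key (k : ℕ) : minpoly K (aeval a F) ∣ g ^ k ↔ h ≤ k := by
    rw [minpoly.dvd_iff, ← aeval_comp, pow_comp, hcomp, ← minpoly.dvd_iff, hmin, mul_pow,
      (⟨hcop.pow.dvd_of_dvd_mul_right, fun h => h.mul_right _⟩ :
        f ^ h ∣ f ^ k * u ^ k ↔ f ^ h ∣ f ^ k), pow_dvd_pow_iff hf.ne_zero hf.not_isUnit]
  obtain ⟨j, -, hj⟩ := (dvd_prime_pow hg.prime h).1 ((key h).2 le_rfl)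
  have hj' := eq_of_monic_of_associated (minpoly.monic ha) (hgm.pow j) hj
  have hjh : j ≤ h := by
    rw [← pow_dvd_pow_iff hg.ne_zero hg.not_isUnit, ← hj']
    exact (key h).2 le_rfl
  have hhj : h ≤ j := (key j).1 hj'.dvd
  rw [hj', le_antisymm hjh hhj]

/-- A matrix whose minimal polynomial has degree its size has charpoly equal to minpoly. -/
theorem charpoly_eq_minpoly_of_natDegree_eq {K ι : Type*} [Field K] [Fintype ι] [DecidableEq ι]
    {M : Matrix ι ι K} (h : (minpoly K M).natDegree = Fintype.card ι) :
    M.charpoly = minpoly K M :=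
  eq_of_monic_of_dvd_of_natDegree_le (minpoly.monic M.isIntegral) M.charpoly_monic
    M.minpoly_dvd_charpoly (by rw [h, M.charpoly_natDegree_eq_dim])

/-- Let `X` be an `n × n` matrix over the finite field `F_q` with cycle type
`f ^ λ` for a monic irreducible polynomial `f` of degree `d`, and let `D` be
the similarity class of `n × n` matrices over `F_q` with cycle type `g ^ λ`
for some monic irreducible polynomial `g` of the same degree `d`.  Then there
exists a polynomial `F ∈ F_q[x]` such that `F(X) ∈ D`. -/
theorem stmt3 {K : Type*} [Field K] [Fintype K] {n m : ℕ}
    (X : Matrix (Fin n) (Fin n) K) (f g : Polynomial K)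
    (hfmonic : f.Monic) (hfirr : Irreducible f)
    (hgmonic : g.Monic) (hgirr : Irreducible g)
    (hdeg : g.natDegree = f.natDegree)
    (lam : Nat.Partition m) (hX : HasPrimaryCycleType X f lam) :
    ∃ F : Polynomial K, HasPrimaryCycleType (Polynomial.aeval X F) g lam := by
  obtain ⟨F, u, hcomp, hcop⟩ := exists_comp_eq_mul_isCoprime hfirr hgirr hdeg
  obtain ⟨L, hL, B, hB, e, P, hP⟩ := hX
  refine ⟨F, L, hL, ?_⟩
  have hmin i : minpoly K (aeval (B i) F) = g ^ L.get i :=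
    minpoly_aeval_eq_pow hfirr hgmonic hgirr hcomp hcop (Matrix.isIntegral _) (hB i).2
  have hchar i : (aeval (B i) F).charpoly = g ^ L.get i := by
    rw [← hmin i]
    apply charpoly_eq_minpoly_of_natDegree_eq
    rw [hmin i, natDegree_pow, hdeg, Fintype.card_fin, mul_comm]
  rw [hdeg]
  refine ⟨fun i => aeval (B i) F, fun i => ⟨hchar i, hmin i⟩, e, P, ?_⟩
  rw [hP, aeval_units_conj, ← aeval_blockDiagonal', ← coe_reindexAlgEquiv K K e,
    aeval_algHom_apply]
end

section
/- Let C and D be similarity classes of n×n matrices over the finite field F_q. Then C and D commute if and only if the class types of C and D commute over F_q. -/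
open Polynomial Matrix

/-- `M` is similar to a direct sum of cyclic blocks, one for each pair `(f, h)`
in the list `c`, the block having characteristic polynomial and minimal
polynomial both equal to `f ^ h`. -/
def HasCycleTypeList {K : Type*} [Field K] {n : ℕ} (M : Matrix (Fin n) (Fin n) K)
    (c : List (Polynomial K × ℕ)) : Prop :=
  ∃ B : (i : Fin c.length) →
      Matrix (Fin ((c.get i).1.natDegree * (c.get i).2))
             (Fin ((c.get i).1.natDegree * (c.get i).2)) K,
    (∀ i, (B i).charpoly = (c.get i).1 ^ (c.get i).2 ∧
          minpoly K (B i) = (c.get i).1 ^ (c.get i).2) ∧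
    ∃ e : ((i : Fin c.length) × Fin ((c.get i).1.natDegree * (c.get i).2)) ≃ Fin n,
      SimilarMat (Matrix.reindex e e (Matrix.blockDiagonal' B)) M

/-- `M` has class type `T`, where a class type is recorded as the multiset of
pairs `(d_i, λ_i)` consisting of the degree `d_i` of each of the distinct monic
irreducible polynomials `f_i` occurring in the cycle type
`f_1^{λ_1} ⋯ f_t^{λ_t}` of `M`, together with the associated partition `λ_i`
(a nonempty multiset of positive parts). -/
def HasClassType {K : Type*} [Field K] {n : ℕ} (M : Matrix (Fin n) (Fin n) K)
    (T : Multiset (ℕ × Multiset ℕ)) : Prop :=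
  ∃ l : List (Polynomial K × Multiset ℕ),
    (l.map Prod.fst).Nodup ∧
    (∀ p ∈ l, p.1.Monic ∧ Irreducible p.1 ∧ p.2 ≠ 0 ∧ ∀ h ∈ p.2, 0 < h) ∧
    T = ↑(l.map fun p => (p.1.natDegree, p.2)) ∧
    ∃ c : List (Polynomial K × ℕ),
      (↑c : Multiset (Polynomial K × ℕ)) = (l.map fun p => p.2.map fun h => (p.1, h)).sum ∧
      HasCycleTypeList M c

/-- Class types `S` and `T` commute over `K` (in dimension `n`) if there exist
commuting `n × n` matrices over `K` with class types `S` and `T` respectively. -/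
def TypesCommute (K : Type*) [Field K] (n : ℕ) (S T : Multiset (ℕ × Multiset ℕ)) : Prop :=
  ∃ X Y : Matrix (Fin n) (Fin n) K, HasClassType X S ∧ HasClassType Y T ∧ Commute X Y

theorem finrank_adjoinRoot {K : Type*} [Field K] {f : K[X]} :
    Module.finrank K (AdjoinRoot f) = f.natDegree := finrank_quotient_span_eq_natDegree

theorem exists_dvd_comp {K : Type*} [Field K] [Finite K] {f g : K[X]}
    (hf : Irreducible f) (hg : Irreducible g) (h : f.natDegree = g.natDegree) :
    ∃ p : K[X], f ∣ g.comp p := by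
  have := Fact.mk hf
  have := Fact.mk hg
  have : Module.Finite K (AdjoinRoot f) := (AdjoinRoot.powerBasis hf.ne_zero).finite
  have : Module.Finite K (AdjoinRoot g) := (AdjoinRoot.powerBasis hg.ne_zero).finite
  have : NeZero g.natDegree := NeZero.of_pos hg.natDegree_pos
  obtain ⟨q, hq⟩ := CharP.exists K
  have : Fact q.Prime := ⟨CharP.char_is_prime K q⟩
  let e : AdjoinRoot g ≃ₐ[K] AdjoinRoot f :=
    (FiniteField.algEquivExtension K q g.natDegree _ finrank_adjoinRoot).trans
      (FiniteField.algEquivExtension K q g.natDegree _ (finrank_adjoinRoot.trans h)).symm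
  obtain ⟨p, hp⟩ := AdjoinRoot.mk_surjective (e (AdjoinRoot.root g))
  refine ⟨p, ?_⟩
  rw [← AdjoinRoot.mk_eq_zero, ← AdjoinRoot.aeval_eq, Polynomial.aeval_comp, AdjoinRoot.aeval_eq,
    hp, ← AlgEquiv.coe_toAlgHom, Polynomial.aeval_algHom_apply, AdjoinRoot.aeval_eq,
    AdjoinRoot.mk_self, map_zero]

theorem exists_dvd_comp_and_not_sq_dvd {K : Type*} [Field K] [Finite K] {f g : K[X]}
    (hf : Irreducible f) (hg : Irreducible g) (h : f.natDegree = g.natDegree) :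
    ∃ p : K[X], f ∣ g.comp p ∧ ¬ f ^ 2 ∣ g.comp p := by
  obtain ⟨p, hp⟩ := exists_dvd_comp hf hg h
  by_cases hp2 : f ^ 2 ∣ g.comp p
  swap
  · exact ⟨p, hp, hp2⟩
  obtain ⟨k, hk⟩ := binomExpansion (g.map C) p f
  have hcomp : g.comp (p + f) = g.comp p + (derivative g).comp p * f + k * f ^ 2 := by
    simpa [derivative_map, eval_map, Polynomial.comp] using hk
  refine ⟨p + f, ?_, fun hd => ?_⟩
  · rw [hcomp]
    exact dvd_add (dvd_add hp (dvd_mul_left _ _))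
      (((dvd_pow_self f two_ne_zero)).mul_left _)
  · have h1 : f ^ 2 ∣ (derivative g).comp p * f := by
      have h2 := (dvd_sub hd (dvd_add hp2 (dvd_mul_left (f ^ 2) k)))
      have : g.comp (p + f) - (g.comp p + k * f ^ 2) = (derivative g).comp p * f := by
        rw [hcomp]; ring
      rwa [this] at h2
    rw [sq] at h1
    have h3 : f ∣ (derivative g).comp p := (mul_dvd_mul_iff_right hf.ne_zero).1 h1
    obtain ⟨a, b, hab⟩ : IsCoprime g (derivative g) := PerfectField.separable_of_irreducible hg
    have h4 := congrArg (fun r => comp r p) hab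
    simp only [add_comp, mul_comp, one_comp] at h4
    exact hf.not_isUnit (isUnit_of_dvd_one (h4 ▸ dvd_add (hp.mul_left _) (h3.mul_left _)))

theorem pow_dvd_comp_iff {K : Type*} [Field K] {f g p : K[X]}
    (hf : Irreducible f) (hg : Irreducible g) (h1 : f ∣ g.comp p) (h2 : ¬ f ^ 2 ∣ g.comp p)
    (h : ℕ) (r : K[X]) : f ^ h ∣ r.comp p ↔ g ^ h ∣ r := by
  constructor
  · intro hd
    induction h generalizing r with
    | zero => simp
    | succ h ih =>
      obtain ⟨s, rfl⟩ := ih r ((pow_dvd_pow f h.le_succ).trans hd)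
      by_cases hs : g ∣ s
      · rw [pow_succ]; exact mul_dvd_mul_left _ hs
      exfalso
      obtain ⟨a, b, hab⟩ := (hg.coprime_iff_not_dvd).2 hs
      have h4 := congrArg (fun r => comp r p) hab
      simp only [add_comp, mul_comp, one_comp] at h4
      have hs' : ¬ f ∣ s.comp p := fun h3 =>
        hf.not_isUnit (isUnit_of_dvd_one (h4 ▸ dvd_add (h1.mul_left _) (h3.mul_left _)))
      obtain ⟨u, hu⟩ := h1
      rw [hu, sq, mul_dvd_mul_iff_left hf.ne_zero] at h2
      rw [mul_comp, pow_comp, hu, mul_pow, mul_assoc, pow_succ,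
        mul_dvd_mul_iff_left (pow_ne_zero _ hf.ne_zero)] at hd
      rcases hf.prime.dvd_or_dvd hd with hd | hd
      · exact h2 (hf.prime.dvd_of_dvd_pow hd)
      · exact hs' hd
  · rintro ⟨s, rfl⟩
    rw [mul_comp, pow_comp]
    exact (pow_dvd_pow_of_dvd h1 h).mul_right _

theorem exists_algEquiv_adjoinRoot_pow {K : Type*} [Field K] {f g p : K[X]}
    (hf : Irreducible f) (hg : Irreducible g) (hd : f.natDegree = g.natDegree)
    (h1 : f ∣ g.comp p) (h2 : ¬ f ^ 2 ∣ g.comp p) (h : ℕ) :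
    ∃ e : AdjoinRoot (f ^ h) ≃ₐ[K] AdjoinRoot (g ^ h),
      e (AdjoinRoot.mk (f ^ h) p) = AdjoinRoot.root (g ^ h) := by
  have : Module.Finite K (AdjoinRoot (f ^ h)) :=
    (AdjoinRoot.powerBasis (pow_ne_zero h hf.ne_zero)).finite
  have : Module.Finite K (AdjoinRoot (g ^ h)) :=
    (AdjoinRoot.powerBasis (pow_ne_zero h hg.ne_zero)).finite
  have key (r : K[X]) : aeval (AdjoinRoot.mk (f ^ h) p) r = 0 ↔ AdjoinRoot.mk (g ^ h) r = 0 := by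
    rw [AdjoinRoot.mk_eq_zero, ← pow_dvd_comp_iff hf hg h1 h2, ← AdjoinRoot.mk_eq_zero,
      ← AdjoinRoot.aeval_eq p, ← aeval_comp, AdjoinRoot.aeval_eq]
  let φ : AdjoinRoot (g ^ h) →ₐ[K] AdjoinRoot (f ^ h) :=
    AdjoinRoot.liftAlgHom (g ^ h) (Algebra.ofId K _) (AdjoinRoot.mk (f ^ h) p)
      ((key _).2 AdjoinRoot.mk_self)
  have hφ (r : K[X]) : φ (AdjoinRoot.mk _ r) = aeval (AdjoinRoot.mk (f ^ h) p) r := rfl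
  have hinj : Function.Injective φ := by
    rw [injective_iff_map_eq_zero]
    intro x hx
    obtain ⟨r, rfl⟩ := AdjoinRoot.mk_surjective x
    exact (key r).1 hx
  have hsurj : Function.Surjective φ :=
    (LinearMap.injective_iff_surjective_of_finrank_eq_finrank (f := φ.toLinearMap) (by
      simp only [finrank_adjoinRoot, natDegree_pow, hd])).1 hinj
  refine ⟨(AlgEquiv.ofBijective φ ⟨hinj, hsurj⟩).symm, ?_⟩
  rw [AlgEquiv.symm_apply_eq]
  refine Eq.symm ((hφ X).trans ?_)
  rw [aeval_X]

theorem exists_simultaneous_comp {K : Type*} [Field K] [Finite K] (s : Finset K[X])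
    (G : K[X] → K[X]) (hs : ∀ f ∈ s, f.Monic ∧ Irreducible f ∧ Irreducible (G f) ∧
      f.natDegree = (G f).natDegree) :
    ∃ p : K[X], ∀ f ∈ s, f ∣ (G f).comp p ∧ ¬ f ^ 2 ∣ (G f).comp p := by
  have hex (f : s) := exists_dvd_comp_and_not_sq_dvd (hs f f.2).2.1 (hs f f.2).2.2.1
    (hs f f.2).2.2.2
  choose x hx1 hx2 using hex
  have hI : Pairwise (Function.onFun IsCoprime fun f : s => Ideal.span {(f : K[X]) ^ 2}) := by
    intro f g hfg
    simp only [Function.onFun]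
    rw [Ideal.isCoprime_span_singleton_iff]
    refine IsCoprime.pow ?_
    rw [(hs f f.2).2.1.coprime_iff_not_dvd]
    intro hd
    exact hfg (Subtype.ext (eq_of_monic_of_associated (hs f f.2).1 (hs g g.2).1
      ((hs f f.2).2.1.associated_of_dvd (hs g g.2).2.1 hd)))
  obtain ⟨p, hp⟩ := Ideal.exists_forall_sub_mem_ideal hI x
  refine ⟨p, fun f hf => ?_⟩
  have h1 : f ^ 2 ∣ (G f).comp p - (G f).comp (x ⟨f, hf⟩) := by
    refine (Ideal.mem_span_singleton.1 (hp ⟨f, hf⟩)).trans ?_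
    simpa [Polynomial.comp, eval₂_eq_eval_map] using sub_dvd_eval_sub p (x ⟨f, hf⟩) ((G f).map C)
  constructor
  · exact (dvd_iff_dvd_of_dvd_sub ((dvd_pow_self f two_ne_zero).trans h1)).2 (hx1 ⟨f, hf⟩)
  · exact fun h => hx2 ⟨f, hf⟩ ((dvd_iff_dvd_of_dvd_sub h1).1 h)

theorem exists_equiv_of_perm {α : Type*} {l l' : List α} (h : l.Perm l') :
    ∃ σ : Fin l.length ≃ Fin l'.length, ∀ i, l'.get (σ i) = l.get i := by
  classical
  have hcard (l : List α) (a : α) : Fintype.card {i // l.get i = a} = l.count a := by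
    rw [Fintype.card_subtype, Finset.card_def, Finset.filter_val, ← Multiset.coe_count]
    conv_rhs => rw [← List.ofFn_get l, ← Fin.univ_val_map, Multiset.count_map]
    simp only [eq_comm]
  have e (a : α) : {i // l.get i = a} ≃ {i // l'.get i = a} :=
    Fintype.equivOfCardEq (by rw [hcard, hcard, h.count_eq])
  exact ⟨Equiv.ofFiberEquiv e, fun i => Equiv.ofFiberEquiv_map e i⟩

/-- The matrix `M` acts on column vectors as multiplication by the class of `X` does
on `∏ i, K[X] / (q i)`. -/
def IsSumOfCyclic {K m ι : Type*} [Field K] [Fintype m] (M : Matrix m m K) (q : ι → K[X]) : Prop :=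
  ∃ e : (m → K) ≃ₗ[K] (∀ i, AdjoinRoot (q i)),
    ∀ v i, e (M *ᵥ v) i = AdjoinRoot.root (q i) * e v i

namespace IsSumOfCyclic

variable {K m n ι κ : Type*} [Field K] [Fintype m] [Fintype n]
  {M : Matrix m m K} {q : ι → K[X]}

theorem comp_equiv (h : IsSumOfCyclic M q) (σ : κ ≃ ι) : IsSumOfCyclic M (q ∘ σ) := by
  obtain ⟨e, he⟩ := h
  exact ⟨e.trans (LinearEquiv.piCongrLeft' K (fun i => AdjoinRoot (q i)) σ.symm),
    fun v i => he v (σ i)⟩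

theorem similarMat [DecidableEq m] {N : Matrix m m K} (hM : IsSumOfCyclic M q) (hN : IsSumOfCyclic N q) :
    SimilarMat M N := by
  obtain ⟨e, he⟩ := hM
  obtain ⟨e', he'⟩ := hN
  let f : (m → K) ≃ₗ[K] (m → K) := e.trans e'.symm
  have hf (v : m → K) : f (M *ᵥ v) = N *ᵥ f v := by
    apply e'.injective
    ext1 i
    simp [f, he, he']
  let P : (Matrix m m K)ˣ :=
    ⟨LinearMap.toMatrix' f.toLinearMap, LinearMap.toMatrix' f.symm.toLinearMap,
      by simp [← LinearMap.toMatrix'_comp], by simp [← LinearMap.toMatrix'_comp]⟩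
  refine ⟨P, ?_⟩
  rw [Units.eq_mul_inv_iff_mul_eq]
  refine Matrix.toLin'.injective (LinearMap.ext fun v => ?_)
  simp [P, Matrix.toLin'_mul, hf]

theorem of_similarMat [DecidableEq m] {N : Matrix m m K} (hM : IsSumOfCyclic M q) (h : SimilarMat M N) :
    IsSumOfCyclic N q := by
  obtain ⟨e, he⟩ := hM
  obtain ⟨P, rfl⟩ := h
  let f : (m → K) ≃ₗ[K] (m → K) := LinearEquiv.ofLinearMap (Matrix.toLin' (P⁻¹ : (Matrix m m K)ˣ))
    (Matrix.toLin' P) (by simp [← Matrix.toLin'_mul]) (by simp [← Matrix.toLin'_mul])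
  refine ⟨f.trans e, fun v i => ?_⟩
  simp [f, ← he, Matrix.mulVec_mulVec, mul_assoc]

theorem reindex (hM : IsSumOfCyclic M q) (e : m ≃ n) : IsSumOfCyclic (Matrix.reindex e e M) q := by
  obtain ⟨f, hf⟩ := hM
  refine ⟨(LinearEquiv.funCongrLeft K K e).trans f, fun v i => ?_⟩
  have : LinearEquiv.funCongrLeft K K e (Matrix.reindex e e M *ᵥ v) =
      M *ᵥ (LinearEquiv.funCongrLeft K K e v) := by
    ext j
    simp [LinearEquiv.funCongrLeft_apply, LinearMap.funLeft_apply, Matrix.mulVec, dotProduct,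
      ← e.sum_comp]
  rw [LinearEquiv.trans_apply, this, hf]
  rfl

theorem blockDiagonal' {s : ι → Type*} [Fintype ι] [DecidableEq ι] [∀ i, Fintype (s i)]
    {B : ∀ i, Matrix (s i) (s i) K} (hB : ∀ i, IsSumOfCyclic (B i) fun _ : Unit => q i) :
    IsSumOfCyclic (Matrix.blockDiagonal' B) q := by
  choose e he using hB
  refine ⟨(LinearEquiv.piCurry K fun (i : ι) (_ : s i) => K).trans (LinearEquiv.piCongrRight fun i =>
    (e i).trans (LinearEquiv.piUnique K fun _ : Unit => AdjoinRoot (q i))), fun v i => ?_⟩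
  have : (fun j => (Matrix.blockDiagonal' B *ᵥ v) ⟨i, j⟩) = B i *ᵥ fun j => v ⟨i, j⟩ := by
    ext j
    simp only [Matrix.mulVec, dotProduct, Fintype.sum_sigma]
    rw [Finset.sum_eq_single i]
    · simp
    · intro k _ hk
      exact Finset.sum_eq_zero fun x _ => by
        rw [Matrix.blockDiagonal'_apply_ne _ _ _ hk.symm, zero_mul]
    · simp
  exact (congrArg (fun w => e i w ()) this).trans (he i _ ())

theorem of_minpoly_eq_pow [DecidableEq m] {f : K[X]} {h : ℕ} (hf : Irreducible f) (hh : 0 < h)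
    (hM : minpoly K M = f ^ h) (hm : Fintype.card m = (f ^ h).natDegree) :
    IsSumOfCyclic M fun _ : Unit => f ^ h := by
  obtain ⟨k, rfl⟩ := Nat.exists_eq_succ_of_ne_zero hh.ne'
  have hne : aeval M (f ^ k) ≠ 0 := by
    intro h0
    have := minpoly.dvd K M h0
    rw [hM, pow_dvd_pow_iff hf.ne_zero hf.not_isUnit] at this
    omega
  obtain ⟨v, hv⟩ : ∃ v : m → K, aeval M (f ^ k) *ᵥ v ≠ 0 := by
    by_contra! hall
    exact hne (Matrix.toLin'.injective (LinearMap.ext fun v => by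
      rw [Matrix.toLin'_apply, hall v, map_zero, LinearMap.zero_apply]))
  have h0 : aeval M (f ^ (k + 1)) = 0 := by rw [← Nat.succ_eq_add_one, ← hM, minpoly.aeval]
  let φ : K[X] →ₗ[K] (m → K) :=
    ((Matrix.toLin' : Matrix m m K ≃ₗ[K] _).toLinearMap.flip v) ∘ₗ (aeval M).toLinearMap
  have hφ (r : K[X]) : φ r = aeval M r *ᵥ v := by simp [φ]
  have hker (r : K[X]) : φ r = 0 ↔ f ^ (k + 1) ∣ r := by
    rw [hφ]
    constructor
    · intro hr
      by_contra hd
      have hr0 : r ≠ 0 := fun h => hd (h ▸ dvd_zero _)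
      obtain ⟨j, s, hs, rfl⟩ := WfDvdMonoid.max_power_factor hr0 hf
      have hj : j ≤ k := by
        by_contra! hj
        exact hd ((pow_dvd_pow f hj).mul_right s)
      obtain ⟨i, rfl⟩ := Nat.exists_eq_add_of_le hj
      obtain ⟨a, b, hab⟩ := (hf.coprime_iff_not_dvd.2 hs).pow_left (m := j + i + 1)
      have hk : f ^ (j + i) = a * f ^ (j + i) * f ^ (j + i + 1) + b * f ^ i * (f ^ j * s) := by
        linear_combination (-f ^ (j + i)) * hab
      apply hv
      rw [hk, map_add, map_mul _ _ (f ^ (j + i + 1)), h0, mul_zero, zero_add, map_mul,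
        ← Matrix.mulVec_mulVec, hr, Matrix.mulVec_zero]
    · rintro ⟨s, rfl⟩
      rw [map_mul, h0, zero_mul, Matrix.zero_mulVec]
  let S := (Ideal.span {f ^ (k + 1)}).restrictScalars K
  have hS : S ≤ LinearMap.ker φ := fun r hr => by
    rw [LinearMap.mem_ker, hker]
    exact Ideal.mem_span_singleton.1 hr
  let ψ : AdjoinRoot (f ^ (k + 1)) →ₗ[K] (m → K) := S.liftQ φ hS
  have hψ (r : K[X]) : ψ (AdjoinRoot.mk _ r) = φ r := rfl
  have hinj : Function.Injective ψ := by
    rw [injective_iff_map_eq_zero]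
    intro x hx
    obtain ⟨r, rfl⟩ := AdjoinRoot.mk_surjective x
    rw [AdjoinRoot.mk_eq_zero, ← hker, ← hψ, hx]
  have : Module.Finite K (AdjoinRoot (f ^ (k + 1))) :=
    (AdjoinRoot.powerBasis (pow_ne_zero _ hf.ne_zero)).finite
  have hsurj : Function.Surjective ψ :=
    (LinearMap.injective_iff_surjective_of_finrank_eq_finrank (by
      rw [finrank_adjoinRoot, Module.finrank_fintype_fun_eq_card, hm])).1 hinj
  let e := LinearEquiv.ofBijective ψ ⟨hinj, hsurj⟩
  refine ⟨e.symm.trans (LinearEquiv.piUnique K fun _ : Unit => AdjoinRoot _).symm, fun w i => ?_⟩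
  obtain ⟨x, rfl⟩ := e.surjective w
  obtain ⟨r, rfl⟩ := AdjoinRoot.mk_surjective x
  have : M *ᵥ e (AdjoinRoot.mk _ r) = e (AdjoinRoot.mk _ (X * r)) := by
    change M *ᵥ φ r = φ (X * r)
    simp [hφ, Matrix.mulVec_mulVec]
  rw [this]
  change e.symm (e _) = _ * e.symm (e _)
  simp

theorem aeval_apply [DecidableEq m] {e : (m → K) ≃ₗ[K] (∀ i, AdjoinRoot (q i))}
    (he : ∀ v i, e (M *ᵥ v) i = AdjoinRoot.root (q i) * e v i) (p : K[X]) (v : m → K) (i : ι) :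
    e (aeval M p *ᵥ v) i = AdjoinRoot.mk (q i) p * e v i := by
  induction p using Polynomial.induction_on generalizing v with
  | C a =>
    rw [aeval_C, Algebra.algebraMap_eq_smul_one, Matrix.smul_mulVec, Matrix.one_mulVec, map_smul,
      Pi.smul_apply, Algebra.smul_def]
    rfl
  | add p r hp hr => simp [Matrix.add_mulVec, hp, hr, add_mul]
  | monomial k a ih =>
    rw [pow_succ, ← mul_assoc, map_mul, ← Matrix.mulVec_mulVec, ih, aeval_X, he,
      map_mul _ _ X, AdjoinRoot.mk_X, mul_assoc]

theorem aeval [DecidableEq m] (hM : IsSumOfCyclic M q) (p : K[X]) {q' : ι → K[X]}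
    (h : ∀ i, ∃ e : AdjoinRoot (q i) ≃ₐ[K] AdjoinRoot (q' i),
      e (AdjoinRoot.mk (q i) p) = AdjoinRoot.root (q' i)) :
    IsSumOfCyclic (aeval M p) q' := by
  obtain ⟨e, he⟩ := hM
  choose f hf using h
  refine ⟨e.trans (LinearEquiv.piCongrRight fun i => (f i).toLinearEquiv), fun v i => ?_⟩
  simp [aeval_apply he, hf]

end IsSumOfCyclic

theorem HasCycleTypeList.isSumOfCyclic {K : Type*} [Field K] {n : ℕ}
    {M : Matrix (Fin n) (Fin n) K} {c : List (K[X] × ℕ)} (h : HasCycleTypeList M c)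
    (hc : ∀ x ∈ c, Irreducible x.1 ∧ 0 < x.2) :
    IsSumOfCyclic M fun i : Fin c.length => (c.get i).1 ^ (c.get i).2 := by
  obtain ⟨B, hB, e, hM⟩ := h
  refine ((IsSumOfCyclic.blockDiagonal' fun i => ?_).reindex e).of_similarMat hM
  obtain ⟨h1, h2⟩ := hc (c.get i) (c.get_mem i)
  exact .of_minpoly_eq_pow h1 h2 (hB i).2 (by simp [mul_comm])

theorem HasCycleTypeList.similarMat_aeval {K : Type*} [Field K] {n : ℕ}
    {M N : Matrix (Fin n) (Fin n) K} {c c' : List (K[X] × ℕ)} {p : K[X]} {G : K[X] → K[X]}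
    (hM : HasCycleTypeList M c) (hN : HasCycleTypeList N c')
    (hperm : (c.map (Prod.map G id)).Perm c')
    (hc : ∀ x ∈ c, Irreducible x.1 ∧ Irreducible (G x.1) ∧ 0 < x.2 ∧
      x.1.natDegree = (G x.1).natDegree ∧ x.1 ∣ (G x.1).comp p ∧ ¬ x.1 ^ 2 ∣ (G x.1).comp p) :
    SimilarMat (aeval M p) N := by
  have hM' := hM.isSumOfCyclic fun x hx => ⟨(hc x hx).1, (hc x hx).2.2.1⟩
  have hN' := hN.isSumOfCyclic fun x hx => by
    obtain ⟨y, hy, rfl⟩ := List.mem_map.1 (hperm.mem_iff.2 hx)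
    exact ⟨(hc y hy).2.1, (hc y hy).2.2.1⟩
  obtain ⟨σ, hσ⟩ := exists_equiv_of_perm hperm
  have hl : c.length = (c.map (Prod.map G id)).length := by simp
  have hN'' := hN'.comp_equiv ((finCongr hl).trans σ)
  refine (hM'.aeval p fun i => ?_).similarMat hN''
  have hi : c'.get (((finCongr hl).trans σ) i) = (G (c.get i).1, (c.get i).2) := by
    rw [Equiv.trans_apply, hσ]
    simp [Prod.map]
  rw [Function.comp_apply, hi]
  obtain ⟨h1, h2, -, h3, h4, h5⟩ := hc (c.get i) (c.get_mem i)
  exact exists_algEquiv_adjoinRoot_pow h1 h2 h3 h4 h5 _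

theorem exists_map_of_classType_eq {K : Type*} [Field K] {l : List (K[X] × Multiset ℕ)}
    (hl : (l.map Prod.fst).Nodup) {L : Multiset (K[X] × Multiset ℕ)}
    (h : (↑(l.map fun p => (p.1.natDegree, p.2)) : Multiset (ℕ × Multiset ℕ)) =
      L.map fun p => (p.1.natDegree, p.2)) :
    ∃ G : K[X] → K[X], (∀ p ∈ l, p.1.natDegree = (G p.1).natDegree) ∧
      L = ↑(l.map (Prod.map G id)) := by
  classical
  induction l generalizing L with
  | nil => exact ⟨id, by simp, by simpa using h.symm⟩
  | cons x l ih =>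
    rw [List.map_cons, List.nodup_cons] at hl
    rw [List.map_cons, ← Multiset.cons_coe, eq_comm] at h
    obtain ⟨y, hy, hyx⟩ : ∃ y ∈ L, (y.1.natDegree, y.2) = (x.1.natDegree, x.2) :=
      Multiset.mem_map.1 (h ▸ Multiset.mem_cons_self _ _)
    obtain ⟨L, rfl⟩ := Multiset.exists_cons_of_mem hy
    rw [Multiset.map_cons, hyx, Multiset.cons_inj_right] at h
    obtain ⟨G, hG1, hG2⟩ := ih hl.2 h.symm
    have hG (p) (hp : p ∈ l) : Function.update G x.1 y.1 p.1 = G p.1 :=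
      Function.update_of_ne (fun hpx => hl.1 (List.mem_map.2 ⟨p, hp, hpx⟩)) _ _
    refine ⟨Function.update G x.1 y.1, ?_, ?_⟩
    · intro p hp
      rcases List.mem_cons.1 hp with rfl | hp
      · simpa using (Prod.mk.inj hyx).1.symm
      · rw [hG p hp, hG1 p hp]
    · rw [List.map_cons, ← Multiset.cons_coe, hG2]
      congr 1
      · exact Prod.ext (by simp) (Prod.mk.inj hyx).2
      · refine congrArg _ (List.map_congr_left fun p hp => ?_)
        exact Prod.ext (hG p hp).symm rfl

theorem HasClassType.exists_similarMat_aeval {K : Type*} [Field K] [Finite K] {n : ℕ}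
    {M N : Matrix (Fin n) (Fin n) K} {T : Multiset (ℕ × Multiset ℕ)}
    (hM : HasClassType M T) (hN : HasClassType N T) :
    ∃ p : K[X], SimilarMat (aeval M p) N := by
  classical
  obtain ⟨l, hl, hl', rfl, c, hc, hMc⟩ := hM
  obtain ⟨l₂, -, hl₂, hT, c₂, hc₂, hNc⟩ := hN
  rw [← Multiset.map_coe _ l₂] at hT
  obtain ⟨G, hdeg, hG⟩ := exists_map_of_classType_eq hl hT
  have hGirr (x) (hx : x ∈ l) : Irreducible (G x.1) := by
    have : Prod.map G id x ∈ (l₂ : Multiset _) := hG ▸ List.mem_map_of_mem hx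
    exact (hl₂ _ this).2.1
  obtain ⟨p, hp⟩ := exists_simultaneous_comp (l.map Prod.fst).toFinset G (by
    intro f hf
    obtain ⟨x, hx, rfl⟩ := List.mem_map.1 (List.mem_toFinset.1 hf)
    exact ⟨(hl' x hx).1, (hl' x hx).2.1, hGirr x hx, hdeg x hx⟩)
  refine ⟨p, hMc.similarMat_aeval hNc (G := G) (Multiset.coe_eq_coe.1 ?_) fun y hy => ?_⟩
  · rw [← Multiset.map_coe, hc, hc₂, ← Multiset.sum_coe, ← Multiset.sum_coe, ← Multiset.map_coe,
      ← Multiset.map_coe, hG]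
    rw [← Multiset.coe_mapAddMonoidHom, map_multiset_sum]
    simp [Function.comp_def, Multiset.map_map]
  · have hy' : y ∈ (l.map fun p => p.2.map fun h => (p.1, h)).sum := hc ▸ hy
    obtain ⟨x, hx, h, hh, rfl⟩ : ∃ x ∈ l, ∃ h ∈ x.2, (x.1, h) = y := by
      rw [← Multiset.sum_coe] at hy'
      simpa using Multiset.mem_join.1 hy'
    exact ⟨(hl' x hx).2.1, hGirr x hx, (hl' x hx).2.2.2 h hh, hdeg x hx,
      hp x.1 (List.mem_toFinset.2 (List.mem_map_of_mem hx))⟩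

theorem SimilarMat.symm {K m : Type*} [CommRing K] [Fintype m] [DecidableEq m]
    {M N : Matrix m m K} (h : SimilarMat M N) : SimilarMat N M := by
  obtain ⟨P, rfl⟩ := h
  exact ⟨P⁻¹, by simp [mul_assoc]⟩

theorem SimilarMat.trans {K m : Type*} [CommRing K] [Fintype m] [DecidableEq m]
    {L M N : Matrix m m K} (h : SimilarMat L M) (h' : SimilarMat M N) : SimilarMat L N := by
  obtain ⟨P, rfl⟩ := h
  obtain ⟨Q, rfl⟩ := h'
  exact ⟨Q * P, by simp [mul_assoc]⟩

theorem Commute.aeval_right {R A : Type*} [CommSemiring R] [Semiring A] [Algebra R A] {a b : A}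
    (h : Commute a b) (p : R[X]) : Commute a (aeval b p) := by
  induction p using Polynomial.induction_on' with
  | add p q hp hq => rw [map_add]; exact hp.add_right hq
  | monomial k c =>
    rw [aeval_monomial]
    exact (Algebra.commute_algebraMap_right c a).mul_right (h.pow_right k)

theorem HasClassType.of_similarMat {K : Type*} [Field K] {n : ℕ}
    {M N : Matrix (Fin n) (Fin n) K} {T : Multiset (ℕ × Multiset ℕ)}
    (hN : HasClassType N T) (h : SimilarMat M N) : HasClassType M T := by
  obtain ⟨l, h1, h2, h3, c, h4, B, h5, e, hB⟩ := hN
  exact ⟨l, h1, h2, h3, c, h4, B, h5, e, hB.trans h.symm⟩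

/-- Let `C` and `D` be the similarity classes of the matrices `A` and `B` over
the finite field `F_q`, with class types `S` and `T`.  Then `C` and `D`
commute (contain commuting elements) if and only if the class types `S` and
`T` commute over `F_q`. -/
theorem stmt6 {K : Type*} [Field K] [Fintype K] {n : ℕ}
    (A B : Matrix (Fin n) (Fin n) K) (S T : Multiset (ℕ × Multiset ℕ))
    (hA : HasClassType A S) (hB : HasClassType B T) :
    (∃ X Y : Matrix (Fin n) (Fin n) K,
        SimilarMat X A ∧ SimilarMat Y B ∧ Commute X Y) ↔
      TypesCommute K n S T := by
  constructor
  · rintro ⟨X, Y, hX, hY, hXY⟩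
    exact ⟨X, Y, hA.of_similarMat hX, hB.of_similarMat hY, hXY⟩
  · rintro ⟨X, Y, hX, hY, hXY⟩
    obtain ⟨p, hp⟩ := hX.exists_similarMat_aeval hA
    obtain ⟨r, hr⟩ := hY.exists_similarMat_aeval hB
    refine ⟨aeval X p, aeval Y r, hp, hr, ?_⟩
    exact (((hXY.aeval_right r).symm).aeval_right p).symm
end
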